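/- (Proposition 1) Let R be a fixed positive integer. For each n > 2R and x ∈ {−1,1}^n define |f_j|² = (∑_{k=0}^{n−1} x_k cos(2πkj/n))² + (∑_{k=0}^{n−1} x_k sin(2πkj/n))² for j = 1, …, R. Then as n → ∞, the pushforward of the uniform probability measure on {−1,1}^n under the map x ↦ ( (2/n)·|f_1|², …, (2/n)·|f_R|² ) ∈ ℝ^R converges weakly (in distribution) to the R-fold product of the chi-square distribution with 2 degrees of freedom, i.e., the R-fold product of the exponential distribution with density (1/2)·exp(−t/2) on [0, ∞); equivalently, the limiting joint density of (|f_1|²/m, …, |f_R|²/m) with m = n/2 is 2^{−R}·exp(−∑_{j=1}^{R} |f_j|²/(2m)). -/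

import Mathlib

open Finset Real Filter MeasureTheory

/-- The squared amplitude of the `j`-th discrete Fourier coefficient:
`|f_j|² = (∑_k x_k cos(2πkj/n))² + (∑_k x_k sin(2πkj/n))²`. -/
noncomputable def absSqDFT (n : ℕ) (j : ℕ) (x : Fin n → ℝ) : ℝ :=
  (∑ k : Fin n, x k * Real.cos (2 * Real.pi * k * j / n)) ^ 2 +
    (∑ k : Fin n, x k * Real.sin (2 * Real.pi * k * j / n)) ^ 2

/-- The exponential distribution with density `(1/2)·exp(−t/2)` on `[0,∞)`, i.e. the
chi-square distribution with 2 degrees of freedom. -/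
noncomputable def chiSqTwo : Measure ℝ :=
  volume.withDensity fun t => ENNReal.ofReal (if 0 ≤ t then Real.exp (-t / 2) / 2 else 0)

lemma abs_prod_sub_prod_le_aux {ι : Type*} (s : Finset ι) (z w : ι → ℝ)
    (hz : ∀ i ∈ s, |z i| ≤ 1) (hw : ∀ i ∈ s, |w i| ≤ 1) :
    |∏ i ∈ s, z i - ∏ i ∈ s, w i| ≤ ∑ i ∈ s, |z i - w i| := by
  classical
  induction s using Finset.induction_on with
  | empty => simp
  | insert a s ha ih =>
    rw [Finset.prod_insert ha, Finset.prod_insert ha, Finset.sum_insert ha]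
    have ih' := ih (fun i hi => hz i (Finset.mem_insert_of_mem hi))
      (fun i hi => hw i (Finset.mem_insert_of_mem hi))
    have h1 : |∏ i ∈ s, z i| ≤ 1 := by
      rw [Finset.abs_prod]
      exact Finset.prod_le_one (fun i _ => abs_nonneg _)
        (fun i hi => hz i (Finset.mem_insert_of_mem hi))
    have h2 := hw a (Finset.mem_insert_self a s)
    have e : z a * ∏ i ∈ s, z i - w a * ∏ i ∈ s, w i =
        (z a - w a) * ∏ i ∈ s, z i + w a * (∏ i ∈ s, z i - ∏ i ∈ s, w i) := by ring
    rw [e]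
    refine (abs_add_le _ _).trans ?_
    rw [abs_mul, abs_mul]
    have := mul_le_mul_of_nonneg_left h1 (abs_nonneg (z a - w a))
    have := mul_le_mul_of_nonneg_right h2 (abs_nonneg (∏ i ∈ s, z i - ∏ i ∈ s, w i))
    linarith

lemma abs_cos_sub_exp_le (a : ℝ) (ha : |a| ≤ 1) :
    |Real.cos a - Real.exp (-(a ^ 2 / 2))| ≤ a ^ 4 := by
  have h1 := Real.cos_bound ha
  have h4 : |a| ^ 4 = a ^ 4 := by
    rw [← abs_pow, abs_of_nonneg (by positivity)]
  rw [h4] at h1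
  have ha2 : a ^ 2 ≤ 1 := by
    rw [← sq_abs]; exact pow_le_one₀ (abs_nonneg _) ha
  have h2 := Real.abs_exp_sub_one_sub_id_le (x := -(a ^ 2 / 2)) (by
    rw [abs_neg, abs_of_nonneg (by positivity)]; linarith)
  have h3 : 0 ≤ a ^ 4 := by positivity
  rw [abs_le] at *
  constructor <;> nlinarith

lemma prod_cos_tendsto (a : ∀ n : ℕ, Fin n → ℝ) (S C : ℝ)
    (hS : ∀ᶠ n in atTop, ∑ k, a n k ^ 2 = S)
    (hC : ∀ n k, a n k ^ 2 ≤ C / n) :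
    Tendsto (fun n => ∏ k, Real.cos (a n k)) atTop (nhds (Real.exp (-(S / 2)))) := by
  have hlim : Tendsto (fun n : ℕ => C / n * S) atTop (nhds 0) := by
    simpa using (tendsto_const_div_atTop_nhds_zero_nat C).mul_const S
  rw [tendsto_iff_dist_tendsto_zero]
  refine squeeze_zero' (Eventually.of_forall fun _ => dist_nonneg) ?_ hlim
  have hsm : ∀ᶠ n : ℕ in atTop, C / n ≤ 1 :=
    (tendsto_const_div_atTop_nhds_zero_nat C).eventually (eventually_le_nhds one_pos)
  filter_upwards [hS, hsm] with n hn hn1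
  have hle : ∀ k, |a n k| ≤ 1 := fun k => by
    rw [← sq_le_one_iff_abs_le_one]; exact (hC n k).trans hn1
  have e : Real.exp (-(S / 2)) = ∏ k, Real.exp (-(a n k ^ 2 / 2)) := by
    rw [← Real.exp_sum, ← hn, Finset.sum_neg_distrib, Finset.sum_div]
  rw [Real.dist_eq, e]
  refine (abs_prod_sub_prod_le_aux _ _ _ (fun k _ => Real.abs_cos_le_one _) (fun k _ => ?_)).trans ?_
  · rw [abs_of_pos (Real.exp_pos _), Real.exp_le_one_iff]
    have := sq_nonneg (a n k); linarith
  · rw [← hn, Finset.mul_sum]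
    refine Finset.sum_le_sum fun k _ => (abs_cos_sub_exp_le _ (hle k)).trans ?_
    have := mul_le_mul_of_nonneg_right (hC n k) (sq_nonneg (a n k))
    calc a n k ^ 4 = a n k ^ 2 * a n k ^ 2 := by ring
      _ ≤ _ := this

/-- the `n`-th roots of unity -/
noncomputable def dftChar (n j k : ℕ) : ℂ :=
  Complex.exp (((2 * Real.pi * k * j / n : ℝ) : ℂ) * Complex.I)

lemma dftChar_norm (n j k : ℕ) : ‖dftChar n j k‖ = 1 := by
  unfold dftChar; exact Complex.norm_exp_ofReal_mul_I _

lemma dftChar_eq (n j k : ℕ) :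
    dftChar n j k = (Complex.exp (2 * Real.pi * Complex.I / n) ^ (j : ℤ)) ^ k := by
  unfold dftChar
  rw [zpow_natCast, ← pow_mul, ← Complex.exp_nat_mul]
  congr 1
  push_cast; ring

lemma sum_root_zpow (n : ℕ) (hn : 0 < n) (m : ℤ) :
    ∑ k : Fin n, (Complex.exp (2 * Real.pi * Complex.I / n) ^ m) ^ (k : ℕ)
      = if (n : ℤ) ∣ m then (n : ℂ) else 0 := by
  have hp := Complex.isPrimitiveRoot_exp n hn.ne'
  rw [Fin.sum_univ_eq_sum_range (fun k => (Complex.exp (2 * Real.pi * Complex.I / n) ^ m) ^ k) n]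
  split_ifs with h
  · rw [(hp.zpow_eq_one_iff_dvd m).2 h]; simp
  · have h1 : Complex.exp (2 * Real.pi * Complex.I / n) ^ m ≠ 1 :=
      fun h' => h ((hp.zpow_eq_one_iff_dvd m).1 h')
    rw [geom_sum_eq h1, ← zpow_natCast, ← zpow_mul, mul_comm m, zpow_mul, zpow_natCast,
      hp.pow_eq_one]
    simp

lemma sum_dftChar_mul (n j l : ℕ) (hj : 0 < j) (hjl : j + l < n) :
    ∑ k : Fin n, dftChar n j k * dftChar n l k = 0 := by
  have h0 : Complex.exp (2 * Real.pi * Complex.I / n) ≠ 0 := Complex.exp_ne_zero _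
  simp_rw [dftChar_eq, ← mul_pow, ← zpow_add₀ h0]
  rw [sum_root_zpow n (by omega), if_neg]
  intro h
  have := Int.le_of_dvd (by omega) h
  omega

lemma sum_dftChar_mul_conj (n j l : ℕ) (hj : j < n) (hl : l < n) :
    ∑ k : Fin n, dftChar n j k * (starRingEnd ℂ) (dftChar n l k) = if j = l then (n : ℂ) else 0 := by
  have h0 : Complex.exp (2 * Real.pi * Complex.I / n) ≠ 0 := Complex.exp_ne_zero _
  have hc : ∀ k, (starRingEnd ℂ) (dftChar n l k) =
      (Complex.exp (2 * Real.pi * Complex.I / n) ^ (-l : ℤ)) ^ k := fun k => by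
    rw [← Complex.inv_eq_conj (dftChar_norm n l k), dftChar_eq, zpow_neg, inv_pow]
  simp_rw [hc, dftChar_eq, ← mul_pow, ← zpow_add₀ h0]
  rw [sum_root_zpow n (by omega)]
  congr 1
  apply propext
  constructor
  · intro h
    have := Int.eq_zero_of_abs_lt_dvd h (by rw [abs_lt]; omega)
    omega
  · rintro rfl; simp

lemma sum_re_mul_re (n j l : ℕ) (hj : 0 < j) (hjl : j + l < n) (s t : ℂ) :
    ∑ k : Fin n, (s * dftChar n j k).re * (t * dftChar n l k).re
      = if j = l then (n : ℝ) / 2 * (s * (starRingEnd ℂ) t).re else 0 := by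
  have key : ∀ u v : ℂ, u.re * v.re = (1 / 2) * (u * v + u * (starRingEnd ℂ) v).re := by
    intro u v; simp; ring
  simp_rw [key]
  rw [← Finset.mul_sum, ← Complex.re_sum, Finset.sum_add_distrib]
  have e1 : ∑ k : Fin n, s * dftChar n j k * (t * dftChar n l k) = 0 := by
    have : ∀ k : Fin n, s * dftChar n j k * (t * dftChar n l k)
      = s * t * (dftChar n j k * dftChar n l k) := fun k => by ring
    simp_rw [this]
    rw [← Finset.mul_sum, sum_dftChar_mul n j l hj hjl, mul_zero]
  have e2 : ∑ k : Fin n, s * dftChar n j k * (starRingEnd ℂ) (t * dftChar n l k)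
      = s * (starRingEnd ℂ) t * if j = l then (n : ℂ) else 0 := by
    rw [← sum_dftChar_mul_conj n j l (by omega) (by omega), Finset.mul_sum]
    refine Finset.sum_congr rfl fun k _ => ?_
    rw [map_mul]; ring
  rw [e1, e2, zero_add]
  split_ifs
  · rw [mul_comm _ (n : ℂ), ← Complex.ofReal_natCast, Complex.re_ofReal_mul]; ring
  · simp

lemma sum_sq_coef (R n : ℕ) (hn : 2 * R < n) (t : Fin R → ℂ) :
    ∑ k : Fin n, (√(2 / n) * ∑ j : Fin R,
      ((starRingEnd ℂ) (t j) * dftChar n (j + 1) k).re) ^ 2 = ∑ j, ‖t j‖ ^ 2 := by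
  have hn0 : (0 : ℝ) < n := by exact_mod_cast (by omega : 0 < n)
  simp_rw [mul_pow, Real.sq_sqrt (show (0 : ℝ) ≤ 2 / n by positivity)]
  rw [← Finset.mul_sum]
  simp_rw [sq (∑ j : Fin R, _), Finset.sum_mul_sum]
  rw [Finset.sum_comm]
  simp_rw [Finset.sum_comm (s := (Finset.univ : Finset (Fin n)))]
  have : ∀ j l : Fin R, ∑ k : Fin n, ((starRingEnd ℂ) (t j) * dftChar n (j + 1) k).re *
      ((starRingEnd ℂ) (t l) * dftChar n (l + 1) k).re
      = if j = l then (n : ℝ) / 2 * ‖t j‖ ^ 2 else 0 := by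
    intro j l
    rw [sum_re_mul_re n _ _ (by omega) (by omega)]
    by_cases h : j = l
    · subst h
      rw [if_pos rfl, if_pos rfl, ← map_mul, Complex.conj_re, Complex.mul_conj,
        Complex.normSq_eq_norm_sq, Complex.ofReal_re]
    · rw [if_neg h, if_neg]
      intro h'; exact h (Fin.ext (by omega))
  simp_rw [this]
  simp only [Finset.sum_ite_eq, Finset.mem_univ, if_true]
  rw [← Finset.mul_sum, ← mul_assoc]
  field_simp

lemma coef_bound (R n k : ℕ) (t : Fin R → ℂ) :
    (√(2 / n) * ∑ j : Fin R, ((starRingEnd ℂ) (t j) * dftChar n (j + 1) k).re) ^ 2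
      ≤ (2 * (∑ j, ‖t j‖) ^ 2) / n := by
  rw [mul_pow, Real.sq_sqrt (by positivity), mul_div_right_comm]
  refine mul_le_mul_of_nonneg_left ?_ (by positivity)
  rw [← sq_abs]
  gcongr
  refine (Finset.abs_sum_le_sum_abs _ _).trans (Finset.sum_le_sum fun j _ => ?_)
  refine (Complex.abs_re_le_norm _).trans ?_
  simp [dftChar_norm]

/-- standard Gaussian measure on the complex plane, by its density -/
noncomputable def gaussC : Measure ℂ :=
  volume.withDensity fun z => ENNReal.ofReal (Real.exp (-‖z‖ ^ 2 / 2) / (2 * Real.pi))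

lemma charFun_gaussC (t : ℂ) : charFun gaussC t = Complex.exp (-(‖t‖ ^ 2 / 2)) := by
  rw [charFun_apply, gaussC, integral_withDensity_eq_integral_toReal_smul (by fun_prop)
    (by simp)]
  have h := GaussianFourier.integral_cexp_neg_mul_sq_norm_add (V := ℂ) (b := 1 / 2)
    (by norm_num) Complex.I t
  have e : ∀ z : ℂ, (ENNReal.ofReal (Real.exp (-‖z‖ ^ 2 / 2) / (2 * Real.pi))).toReal •
      Complex.exp (inner ℝ z t * Complex.I) = (1 / (2 * Real.pi) : ℂ) *
      Complex.exp (-(1 / 2) * ‖z‖ ^ 2 + Complex.I * (inner ℝ t z : ℝ)) := by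
    intro z
    rw [ENNReal.toReal_ofReal (by positivity), Complex.exp_add, Complex.real_smul,
      real_inner_comm]
    push_cast
    rw [mul_comm Complex.I, show (-(‖z‖ : ℂ) ^ 2 / 2) = -(1 / 2) * ‖z‖ ^ 2 by ring]
    ring
  simp_rw [e]
  rw [integral_const_mul, h, Complex.finrank_real_complex]
  have hpi : (Real.pi : ℂ) ≠ 0 := by exact_mod_cast Real.pi_ne_zero
  have e1 : ((2 : ℕ) / 2 : ℂ) = 1 := by norm_num
  rw [e1, Complex.cpow_one, Complex.I_sq, ← mul_assoc]
  have e2 : (1 / (2 * Real.pi) : ℂ) * (Real.pi / (1 / 2)) = 1 := by field_simp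
  rw [e2, one_mul]
  congr 1
  ring

instance : IsProbabilityMeasure gaussC := by
  have h := charFun_gaussC 0
  rw [charFun_zero] at h
  simp at h
  constructor
  rw [measureReal_def] at h
  exact (ENNReal.toReal_eq_one_iff _).1 h

lemma map_gaussC : gaussC.map (fun z => ‖z‖ ^ 2) = chiSqTwo := by
  ext A hA
  have hm : Measurable (fun z : ℂ => ‖z‖ ^ 2) := by fun_prop
  rw [Measure.map_apply hm hA, gaussC, withDensity_apply _ (hm hA), chiSqTwo,
    withDensity_apply _ hA, ← lintegral_indicator (hm hA), ← lintegral_indicator hA,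
    ← Complex.lintegral_comp_polarCoord_symm]
  set F : ℝ → ENNReal := A.indicator (fun t => ENNReal.ofReal (Real.exp (-t / 2) / 2)) with hF
  have hFm : Measurable F := Measurable.indicator (by fun_prop) hA
  have hR : ∫⁻ a, A.indicator
      (fun t => ENNReal.ofReal (if 0 ≤ t then Real.exp (-t / 2) / 2 else 0)) a
      = ∫⁻ a in Set.Ioi 0, F a := by
    rw [setLIntegral_congr Ioi_ae_eq_Ici, ← lintegral_indicator measurableSet_Ici]
    congr 1 with a
    by_cases h1 : a ∈ A <;> by_cases h2 : 0 ≤ a <;> simp [hF, h1, h2]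
  have himg : (fun r : ℝ => r ^ 2) '' Set.Ioi 0 = Set.Ioi 0 := by
    ext y
    constructor
    · rintro ⟨r, hr, rfl⟩
      have : 0 < r := hr
      exact Set.mem_Ioi.2 (by positivity)
    · intro hy
      exact ⟨√y, Real.sqrt_pos.2 hy, Real.sq_sqrt (le_of_lt hy)⟩
  have hsub : ∫⁻ a in Set.Ioi 0, F a
      = ∫⁻ r in Set.Ioi (0 : ℝ), ENNReal.ofReal |2 * r| * F (r ^ 2) := by
    conv_lhs => rw [← himg]
    refine lintegral_image_eq_lintegral_abs_deriv_mul measurableSet_Ioi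
      (f' := fun r => 2 * r) (fun x _ => ?_) ?_ F
    · simpa using (hasDerivAt_pow 2 x).hasDerivWithinAt
    · intro x hx y hy h
      exact (pow_left_inj₀ (le_of_lt hx) (le_of_lt hy) two_ne_zero).1 h
  rw [hR, hsub, polarCoord_target, Measure.volume_eq_prod, ← Measure.prod_restrict]
  have hcongr : ∀ᵐ p ∂((volume.restrict (Set.Ioi (0 : ℝ))).prod
      (volume.restrict (Set.Ioo (-Real.pi) Real.pi))),
      ENNReal.ofReal p.1 • ((fun z : ℂ => ‖z‖ ^ 2) ⁻¹' A).indicator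
        (fun z => ENNReal.ofReal (Real.exp (-‖z‖ ^ 2 / 2) / (2 * Real.pi)))
        (Complex.polarCoord.symm p)
      = (ENNReal.ofReal |2 * p.1| * F (p.1 ^ 2)) * ENNReal.ofReal (1 / (2 * Real.pi)) := by
    rw [Measure.prod_restrict]
    filter_upwards [ae_restrict_mem (measurableSet_Ioi.prod measurableSet_Ioo)] with p hp
    have hp0 : 0 < p.1 := hp.1
    have hnorm : ‖Complex.polarCoord.symm p‖ = p.1 := by
      rw [Complex.norm_polarCoord_symm, abs_of_pos hp0]
    by_cases h : p.1 ^ 2 ∈ A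
    · rw [Set.indicator_of_mem (by simpa [hnorm] using h), hF, Set.indicator_of_mem h, hnorm,
        smul_eq_mul, ← ENNReal.ofReal_mul hp0.le, ← ENNReal.ofReal_mul (abs_nonneg _),
        ← ENNReal.ofReal_mul (by positivity), abs_of_pos (by positivity)]
      congr 1
      have := Real.pi_ne_zero
      field_simp
    · rw [Set.indicator_of_notMem (by simpa [hnorm] using h), hF, Set.indicator_of_notMem h]
      simp
  rw [lintegral_congr_ae hcongr, lintegral_prod_mul (f := fun r => ENNReal.ofReal |2 * r| * F (r ^ 2))
    (g := fun _ => ENNReal.ofReal (1 / (2 * Real.pi))) (by fun_prop) (by fun_prop)]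
  rw [lintegral_const, Measure.restrict_apply_univ, Real.volume_Ioo,
    ← ENNReal.ofReal_mul (by positivity)]
  have : 1 / (2 * Real.pi) * (Real.pi - -Real.pi) = 1 := by
    have := Real.pi_ne_zero
    field_simp; ring
  rw [this]; simp

/-- The normalized spectrum, as a vector of complex numbers. -/
noncomputable def specVec (R n : ℕ) (x : Fin n → ({-1, 1} : Finset ℝ)) :
    PiLp 2 (fun _ : Fin R => ℂ) :=
  WithLp.toLp 2 fun j => ((√(2 / n) : ℝ) : ℂ) * ∑ k : Fin n, ((x k : ℝ) : ℂ) * dftChar n (j + 1) k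

/-- The law of the normalized spectrum. -/
noncomputable def specLaw (R n : ℕ) : Measure (PiLp 2 (fun _ : Fin R => ℂ)) :=
  ∑ x : Fin n → ({-1, 1} : Finset ℝ), ((2 : ENNReal) ^ n)⁻¹ • Measure.dirac (specVec R n x)

lemma card_signs (n : ℕ) : Fintype.card (Fin n → ({-1, 1} : Finset ℝ)) = 2 ^ n := by
  rw [Fintype.card_fun, Fintype.card_coe, Fintype.card_fin, Finset.card_pair (by norm_num)]

instance (R n : ℕ) : IsProbabilityMeasure (specLaw R n) := by
  constructor
  simp only [specLaw, Measure.coe_finsetSum, Finset.sum_apply, Measure.smul_apply, measure_univ,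
    smul_eq_mul, mul_one, Finset.sum_const, Finset.card_univ, card_signs, nsmul_eq_mul]
  push_cast
  exact ENNReal.mul_inv_cancel (by positivity) (by finiteness)

lemma integral_specLaw {G : Type*} [NormedAddCommGroup G] [NormedSpace ℝ G] [CompleteSpace G]
    (R n : ℕ) (f : PiLp 2 (fun _ : Fin R => ℂ) → G) :
    ∫ z, f z ∂(specLaw R n) = ((2 : ℝ) ^ n)⁻¹ • ∑ x, f (specVec R n x) := by
  rw [specLaw, integral_finsetSum_measure]
  · simp [integral_smul_measure, Finset.smul_sum]
  · intro x _
    exact (integrable_dirac (by finiteness)).smul_measure (by simp)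

lemma normSq_specVec (R n : ℕ) (x : Fin n → ({-1, 1} : Finset ℝ)) (j : Fin R) :
    ‖specVec R n x j‖ ^ 2 = (2 / (n : ℝ)) * absSqDFT n (j.val + 1) (fun k => (x k : ℝ)) := by
  simp only [specVec, absSqDFT]
  rw [norm_mul, mul_pow, Complex.norm_real, Real.norm_eq_abs, sq_abs,
    Real.sq_sqrt (by positivity), ← Complex.normSq_eq_norm_sq, Complex.normSq_apply,
    Complex.re_sum, Complex.im_sum]
  simp only [Complex.re_ofReal_mul, Complex.im_ofReal_mul, dftChar, Complex.exp_ofReal_mul_I_re,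
    Complex.exp_ofReal_mul_I_im, sq]

lemma inner_specVec (R n : ℕ) (x : Fin n → ({-1, 1} : Finset ℝ))
    (t : PiLp 2 (fun _ : Fin R => ℂ)) :
    inner ℝ (specVec R n x) t = ∑ k : Fin n, (x k : ℝ) * (√(2 / n) * ∑ j : Fin R,
      ((starRingEnd ℂ) (t j) * dftChar n (j + 1) k).re) := by
  rw [PiLp.inner_apply]
  simp only [specVec]
  simp_rw [Finset.mul_sum]
  rw [Finset.sum_comm]
  refine Finset.sum_congr rfl fun j _ => ?_
  rw [real_inner_comm, Complex.inner, mul_comm _ ((starRingEnd ℂ) (t j)), Finset.mul_sum, Complex.re_sum]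
  refine Finset.sum_congr rfl fun k _ => ?_
  rw [show (starRingEnd ℂ) (t j) * (((√(2 / n) : ℝ) : ℂ) * (((x k : ℝ) : ℂ) * dftChar n (j + 1) k))
    = (((x k : ℝ) * √(2 / n) : ℝ) : ℂ) * ((starRingEnd ℂ) (t j) * dftChar n (j + 1) k) by
      push_cast; ring, Complex.re_ofReal_mul]
  ring

lemma charFun_specLaw (R n : ℕ) (t : PiLp 2 (fun _ : Fin R => ℂ)) :
    charFun (specLaw R n) t = ((∏ k : Fin n, Real.cos (√(2 / n) * ∑ j : Fin R,
      ((starRingEnd ℂ) (t j) * dftChar n (j + 1) k).re) : ℝ) : ℂ) := by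
  rw [charFun_apply, integral_specLaw]
  simp_rw [inner_specVec]
  set a : Fin n → ℝ := fun k => √(2 / n) * ∑ j : Fin R,
      ((starRingEnd ℂ) (t j) * dftChar n (j + 1) k).re with ha
  have e : ∀ x : Fin n → ({-1, 1} : Finset ℝ),
      Complex.exp (((∑ k : Fin n, (x k : ℝ) * a k : ℝ) : ℂ) * Complex.I)
      = ∏ k, Complex.exp ((((x k : ℝ) * a k : ℝ) : ℂ) * Complex.I) := by
    intro x
    rw [← Complex.exp_sum, Complex.ofReal_sum, Finset.sum_mul]
  change _ • ∑ x : Fin n → ({-1, 1} : Finset ℝ),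
      Complex.exp (((∑ k : Fin n, (x k : ℝ) * a k : ℝ) : ℂ) * Complex.I) = _
  simp_rw [e]
  have h := Finset.prod_univ_sum (fun _ : Fin n => (Finset.univ : Finset ({-1, 1} : Finset ℝ)))
    (fun k y => Complex.exp ((((y : ℝ) * a k : ℝ) : ℂ) * Complex.I))
  rw [Fintype.piFinset_univ] at h
  rw [← h]
  have h2 : ∀ k, ∑ y : ({-1, 1} : Finset ℝ), Complex.exp ((((y : ℝ) * a k : ℝ) : ℂ) * Complex.I)
      = 2 * ((Real.cos (a k) : ℝ) : ℂ) := by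
    intro k
    rw [Finset.sum_coe_sort ({-1, 1} : Finset ℝ)
      (fun y : ℝ => Complex.exp (((y * a k : ℝ) : ℂ) * Complex.I)),
      Finset.sum_pair (by norm_num), Complex.ofReal_cos, Complex.two_cos]
    push_cast
    simp [add_comm]
  simp_rw [h2]
  rw [Finset.prod_mul_distrib, Finset.prod_const, Finset.card_univ, Fintype.card_fin,
    Complex.real_smul]
  rw [Complex.ofReal_prod, Complex.ofReal_inv, Complex.ofReal_pow, Complex.ofReal_ofNat,
    ← mul_assoc, inv_mul_cancel₀ (pow_ne_zero n two_ne_zero), one_mul]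

/-- The limiting Gaussian law. -/
noncomputable def gaussLaw (R : ℕ) : Measure (PiLp 2 (fun _ : Fin R => ℂ)) :=
  (Measure.pi fun _ : Fin R => gaussC).map (WithLp.toLp 2)

instance (R : ℕ) : IsProbabilityMeasure (gaussLaw R) :=
  Measure.isProbabilityMeasure_map (by fun_prop)

lemma charFun_gaussLaw (R : ℕ) (t : PiLp 2 (fun _ : Fin R => ℂ)) :
    charFun (gaussLaw R) t = ((Real.exp (-((∑ j, ‖t j‖ ^ 2) / 2)) : ℝ) : ℂ) := by
  rw [gaussLaw, charFun_pi]
  simp_rw [charFun_gaussC]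
  rw [← Complex.exp_sum]
  push_cast
  rw [Finset.sum_neg_distrib, Finset.sum_div]

lemma tendsto_charFun_specLaw (R : ℕ) (t : PiLp 2 (fun _ : Fin R => ℂ)) :
    Tendsto (fun n => charFun (specLaw R n) t) atTop (nhds (charFun (gaussLaw R) t)) := by
  simp_rw [charFun_specLaw, charFun_gaussLaw]
  refine (Complex.continuous_ofReal.tendsto _).comp ?_
  refine prod_cos_tendsto (fun n k => √(2 / n) * ∑ j : Fin R,
      ((starRingEnd ℂ) (t j) * dftChar n (j + 1) k).re) _ (2 * (∑ j, ‖t j‖) ^ 2) ?_ ?_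
  · filter_upwards [eventually_gt_atTop (2 * R)] with n hn
    exact sum_sq_coef R n hn _
  · intro n k
    exact coef_bound R n k _

lemma map_pi_gaussC (R : ℕ) :
    (Measure.pi fun _ : Fin R => gaussC).map (fun z j => ‖z j‖ ^ 2)
      = Measure.pi fun _ : Fin R => chiSqTwo := by
  have : IsProbabilityMeasure chiSqTwo := by
    rw [← map_gaussC]; exact Measure.isProbabilityMeasure_map (by fun_prop)
  have h := Measure.pi_map_pi (μ := fun _ : Fin R => gaussC)
    (f := fun (_ : Fin R) (z : ℂ) => ‖z‖ ^ 2)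
    (hμ := fun i => by rw [map_gaussC]; infer_instance) (fun _ => by fun_prop)
  rw [h]
  simp_rw [map_gaussC]

/-- Proposition 1: the distribution of `((2/n)|f_1|², …, (2/n)|f_R|²)` under the uniform
probability measure on `{-1,1}^n` converges weakly, as `n → ∞`, to the `R`-fold product
of the chi-square distribution with 2 degrees of freedom: the expectation of every
bounded continuous function converges to the corresponding integral. -/
theorem normalized_spectrum_tendsto_chiSq (R : ℕ) (hR : 0 < R)
    (g : BoundedContinuousFunction (Fin R → ℝ) ℝ) :
    Tendsto (fun n : ℕ =>
        (∑ x : Fin n → ({-1, 1} : Finset ℝ),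
          g (fun j : Fin R =>
            (2 / (n : ℝ)) * absSqDFT n (j.val + 1) (fun k => (x k : ℝ)))) / 2 ^ n)
      atTop
      (nhds (∫ y, g y ∂(Measure.pi fun _ : Fin R => chiSqTwo))) := by
  let P : ℕ → ProbabilityMeasure (PiLp 2 (fun _ : Fin R => ℂ)) :=
    fun n => ⟨specLaw R n, inferInstance⟩
  let Q : ProbabilityMeasure (PiLp 2 (fun _ : Fin R => ℂ)) := ⟨gaussLaw R, inferInstance⟩
  have hw : Tendsto P atTop (nhds Q) :=
    ProbabilityMeasure.tendsto_of_tendsto_charFun (μ := P) (μ₀ := Q)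
      fun t => tendsto_charFun_specLaw R t
  rw [ProbabilityMeasure.tendsto_iff_forall_integral_tendsto] at hw
  let Φ : C(PiLp 2 (fun _ : Fin R => ℂ), Fin R → ℝ) := ⟨fun z j => ‖z j‖ ^ 2, by fun_prop⟩
  have h := hw (g.compContinuous Φ)
  have e0 : ∫ z, (g.compContinuous Φ) z ∂(gaussLaw R)
      = ∫ y, g y ∂(Measure.pi fun _ : Fin R => chiSqTwo) := by
    rw [gaussLaw, integral_map (by fun_prop)
      (g.compContinuous Φ).continuous.aestronglyMeasurable, ← map_pi_gaussC,
      integral_map (Measurable.aemeasurable (by fun_prop)) g.continuous.aestronglyMeasurable]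
    rfl
  simp only [P, Q, ProbabilityMeasure.coe_mk, integral_specLaw, e0] at h
  refine h.congr fun n => ?_
  rw [smul_eq_mul, div_eq_inv_mul]
  congr 1
  refine Finset.sum_congr rfl fun x _ => ?_
  simp only [BoundedContinuousFunction.compContinuous_apply, Φ, ContinuousMap.coe_mk,
    normSq_specVec]
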